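/- arXiv:1802.06281 — 2 statements merged into one kernel-verified Lean document; each statement's English description precedes it below -/
import Mathlib

section
/- Let S be a 0-cancellative semigroup with zero admitting least common multiples. For i = 1, 2 let Λ_i be a finite subset of ~S with Λ_i ∩ S ≠ ∅ and let u_i, v_i ∈ Λ_i be such that θ_{u_1} f_{Λ_1} θ_{v_1}^{-1} = θ_{u_2} f_{Λ_2} θ_{v_2}^{-1} ≠ 0 in H(S). Then there exist x_1, x_2 ∈ ~S such that: (i) θ_{u_i} f_{Λ_i} θ_{v_i}^{-1} = θ_{u_i x_i} f_{Λ_i x_i} θ_{v_i x_i}^{-1} for i = 1, 2; (ii) u_1 x_1 = u_2 x_2 and F_{Λ_1 x_1} = F_{Λ_2 x_2}; and moreover at least one of the following holds: (a) v_1 x_1 = v_2 x_2; (b) v_1 x_1 is an idempotent element of S, θ_{v_1 x_1} ≥ f_{Λ_1 x_1}, and v_2 = x_2 = 1; (c) the statement (b) with the subscripts 1 and 2 interchanged. -/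
/-- A semigroup with zero is `0`-left cancellative if `s*t = s*r ≠ 0` implies `t = r`. -/
def ZeroLeftCancellative (S : Type*) [SemigroupWithZero S] : Prop :=
  ∀ s t r : S, s * t = s * r → s * t ≠ 0 → t = r

/-- A semigroup with zero is `0`-right cancellative if `t*s = r*s ≠ 0` implies `t = r`. -/
def ZeroRightCancellative (S : Type*) [SemigroupWithZero S] : Prop :=
  ∀ t r s : S, t * s = r * s → t * s ≠ 0 → t = r

/-- `s` divides `t` when `t ∈ {s} ∪ sS`. -/
def Divides {S : Type*} [Mul S] (s t : S) : Prop := t = s ∨ ∃ u, s * u = t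

/-- `r` is a least common multiple of `s` and `t` when `sS ∩ tS = rS` and both `s` and `t`
divide `r`. -/
def IsLCM {S : Type*} [Mul S] (s t r : S) : Prop :=
  ({x | ∃ u, x = s * u} ∩ {x | ∃ u, x = t * u} = {x | ∃ u, x = r * u}) ∧
    Divides s r ∧ Divides t r

/-- The regular representation: `theta s` is the graph of the partial bijection
`θ_s : F_s → E_s`, `x ↦ s*x`, of `S' = S \ {0}`. -/
def theta {S : Type*} [SemigroupWithZero S] (s : S) : S → S → Prop :=
  fun x y => x ≠ 0 ∧ s * x ≠ 0 ∧ y = s * x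

/-- The identity partial bijection on a subset `X`, viewed as a relation. -/
def idOn {α : Type*} (X : Set α) : α → α → Prop := fun x y => x = y ∧ x ∈ X

/-- Multiplication in `~S = S ∪ {1}`, modelled as `Option S` with `none` the adjoined
unit `1`. -/
def tmul {S : Type*} [Mul S] : Option S → Option S → Option S
  | none, y => y
  | some s, none => some s
  | some s, some t => some (s * t)

/-- The regular representation extended to `~S`, with `θ_1` the identity map of `S'`. -/
def etheta {S : Type*} [SemigroupWithZero S] : Option S → S → S → Prop
  | none => fun x y => x = y ∧ x ≠ 0
  | some s => theta s

/-- `F_Λ = ⋂_{w ∈ Λ} F_w`, the intersection of the domains of the `θ_w`, `w ∈ Λ ⊆ ~S`. -/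
def FLam {S : Type*} [SemigroupWithZero S] (Λ : Set (Option S)) : Set S :=
  {x | ∀ w ∈ Λ, ∃ y, etheta w x y}

/-- The element `θ_u ∘ f_Λ ∘ θ_v⁻¹` of the inverse hull, as a relation on `S`. -/
def triple {S : Type*} [SemigroupWithZero S]
    (u : Option S) (Λ : Set (Option S)) (v : Option S) : S → S → Prop :=
  fun x z => ∃ m, etheta v m x ∧ m ∈ FLam Λ ∧ etheta u m z

/-- The natural partial order of the symmetric inverse semigroup:
`f ≤ g` iff `f = g ∘ f⁻¹ ∘ f`. -/
def NatLE {α : Type*} (f g : α → α → Prop) : Prop :=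
  f = Relation.Comp (Relation.Comp f (flip f)) g

/-- The left action of `~S` on `S`. -/
def tact {S : Type*} [Mul S] : Option S → S → S
  | none, x => x
  | some s, x => s * x

section Helpers

variable {S : Type*} [SemigroupWithZero S]

theorem tact_tmul (u v : Option S) (x : S) : tact (tmul u v) x = tact u (tact v x) := by
  cases u <;> cases v <;> simp [tact, tmul, mul_assoc]

theorem tact_zero (u : Option S) : tact u 0 = 0 := by
  cases u <;> simp [tact]

theorem ne_zero_of_tact_ne_zero {u : Option S} {x : S} (h : tact u x ≠ 0) : x ≠ 0 := by
  rintro rfl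
  exact h (tact_zero u)

theorem etheta_iff {u : Option S} {x y : S} : etheta u x y ↔ tact u x ≠ 0 ∧ y = tact u x := by
  cases u with
  | none => simp only [etheta, tact]; grind
  | some s =>
    exact ⟨fun h => h.2, fun h => ⟨ne_zero_of_tact_ne_zero h.1, h⟩⟩

theorem mem_FLam_iff {Λ : Set (Option S)} {x : S} : x ∈ FLam Λ ↔ ∀ w ∈ Λ, tact w x ≠ 0 := by
  simp [FLam, etheta_iff]

theorem mem_FLam_image_iff {Λ : Set (Option S)} {x : Option S} {y : S} :
    y ∈ FLam ((fun w => tmul w x) '' Λ) ↔ tact x y ∈ FLam Λ := by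
  simp [mem_FLam_iff, tact_tmul]

theorem triple_iff {Λ : Set (Option S)} {u v : Option S} (hu : u ∈ Λ) (hv : v ∈ Λ) {a b : S} :
    triple u Λ v a b ↔ ∃ m ∈ FLam Λ, a = tact v m ∧ b = tact u m := by
  simp only [triple, etheta_iff]
  constructor
  · rintro ⟨m, ⟨_, ha⟩, hm, _, hb⟩
    exact ⟨m, hm, ha, hb⟩
  · rintro ⟨m, hm, ha, hb⟩
    have h := mem_FLam_iff.1 hm
    exact ⟨m, ⟨h v hv, ha⟩, hm, h u hu, hb⟩

theorem triple_eq_triple_tmul {Λ : Set (Option S)} {u v x : Option S} (hu : u ∈ Λ) (hv : v ∈ Λ)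
    (hx : ∀ m ∈ FLam Λ, ∃ y, m = tact x y) :
    triple u Λ v = triple (tmul u x) ((fun w => tmul w x) '' Λ) (tmul v x) := by
  ext a b
  rw [triple_iff hu hv, triple_iff (Set.mem_image_of_mem (fun w => tmul w x) hu)
    (Set.mem_image_of_mem (fun w => tmul w x) hv)]
  simp only [mem_FLam_image_iff, tact_tmul]
  constructor
  · rintro ⟨m, hm, ha, hb⟩
    obtain ⟨y, rfl⟩ := hx m hm
    exact ⟨y, hm, ha, hb⟩
  · rintro ⟨y, hm, ha, hb⟩
    exact ⟨_, hm, ha, hb⟩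

theorem tact_left_cancel (hlc : ZeroLeftCancellative S) {u : Option S} {x y : S}
    (h : tact u x = tact u y) (h0 : tact u x ≠ 0) : x = y := by
  cases u with
  | none => exact h
  | some s => exact hlc s x y h h0

theorem Divides.exists_tmul_eq {s r : S} (h : Divides s r) :
    ∃ x : Option S, tmul (some s) x = some r := by
  obtain rfl | ⟨x, rfl⟩ := h
  · exact ⟨none, rfl⟩
  · exact ⟨some x, rfl⟩

/-- Least common multiples in `~S`, in terms of the action on `S`. -/
theorem exists_tmul_eq_tmul (hlc : ZeroLeftCancellative S)
    (hlcm : ∀ s t : S, ∃ r : S, IsLCM s t r) (u₁ u₂ : Option S) :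
    ∃ x₁ x₂ : Option S, tmul u₁ x₁ = tmul u₂ x₂ ∧
      ∀ m₁ m₂ : S, tact u₁ m₁ = tact u₂ m₂ → tact u₁ m₁ ≠ 0 →
        ∃ y, m₁ = tact x₁ y ∧ m₂ = tact x₂ y := by
  match u₁, u₂ with
  | none, u₂ => exact ⟨u₂, none, by cases u₂ <;> rfl, fun m₁ m₂ h _ => ⟨m₂, h, rfl⟩⟩
  | some s, none => exact ⟨none, some s, rfl, fun m₁ m₂ h _ => ⟨m₁, rfl, h.symm⟩⟩
  | some s, some t =>
    obtain ⟨r, hr, hs, ht⟩ := hlcm s t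
    obtain ⟨x₁, h₁⟩ := hs.exists_tmul_eq
    obtain ⟨x₂, h₂⟩ := ht.exists_tmul_eq
    refine ⟨x₁, x₂, h₁.trans h₂.symm, fun m₁ m₂ h h0 => ?_⟩
    obtain ⟨y, hy⟩ : ∃ y, s * m₁ = r * y := by
      have hmem : s * m₁ ∈ {x | ∃ u, x = s * u} ∩ {x | ∃ u, x = t * u} := ⟨⟨m₁, rfl⟩, ⟨m₂, h⟩⟩
      rw [hr] at hmem
      exact hmem
    have hy₁ : tact (some s) m₁ = tact (some s) (tact x₁ y) := by
      rw [← tact_tmul, h₁]; exact hy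
    have hy₂ : tact (some t) m₂ = tact (some t) (tact x₂ y) := by
      rw [← h, ← tact_tmul, h₂]; exact hy
    exact ⟨y, tact_left_cancel hlc hy₁ h0, tact_left_cancel hlc hy₂ (h ▸ h0)⟩

theorem mul_self_of_mul_eq (hrc : ZeroRightCancellative S) {w y : S} (h : w * y = y)
    (h0 : y ≠ 0) : w * w = w :=
  hrc (w * w) w y (by rw [mul_assoc, h, h]) (by rw [mul_assoc, h, h]; exact h0)

theorem natLE_idOn_etheta {X : Set S} {w : Option S} (h : ∀ y ∈ X, tact w y = y ∧ y ≠ 0) :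
    NatLE (idOn X) (etheta w) := by
  ext a b
  simp only [Relation.Comp, flip, idOn, etheta_iff]
  constructor
  · rintro ⟨rfl, ha⟩
    obtain ⟨e, h0⟩ := h a ha
    exact ⟨a, ⟨a, ⟨rfl, ha⟩, rfl, ha⟩, e.symm ▸ h0, e.symm⟩
  · rintro ⟨_, ⟨_, ⟨rfl, ha⟩, rfl, _⟩, _, rfl⟩
    exact ⟨(h _ ha).1.symm, ha⟩

theorem tmul_eq_none {u v : Option S} (h : tmul u v = none) : u = none ∧ v = none := by
  cases u <;> cases v <;> simp_all [tmul]

/-- If `triple u₁ Λ₁ v₁ ≤ triple u₂ Λ₂ v₂` and `u₁ x₁ = u₂ x₂` then `v₁ x₁` and `v₂ x₂` agree on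
`F_{Λ₁ x₁}`, which is contained in `F_{Λ₂ x₂}`. -/
theorem tact_eq_of_triple_le (hlc : ZeroLeftCancellative S) {Λ₁ Λ₂ : Set (Option S)}
    {u₁ v₁ u₂ v₂ x₁ x₂ : Option S} (hu₁ : u₁ ∈ Λ₁) (hv₁ : v₁ ∈ Λ₁) (hu₂ : u₂ ∈ Λ₂) (hv₂ : v₂ ∈ Λ₂)
    (hle : triple u₁ Λ₁ v₁ ≤ triple u₂ Λ₂ v₂) (hx : tmul u₁ x₁ = tmul u₂ x₂) {y : S}
    (hy : tact x₁ y ∈ FLam Λ₁) :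
    tact x₂ y ∈ FLam Λ₂ ∧ tact v₁ (tact x₁ y) = tact v₂ (tact x₂ y) := by
  obtain ⟨m, hm, ha, hb⟩ :=
    (triple_iff hu₂ hv₂).1 (hle _ _ ((triple_iff hu₁ hv₁).2 ⟨_, hy, rfl, rfl⟩))
  rw [← tact_tmul, hx, tact_tmul] at hb
  obtain rfl := tact_left_cancel hlc hb.symm (mem_FLam_iff.1 hm _ hu₂)
  exact ⟨hm, ha⟩

end Helpers

/-- Relations between two representations `θ_{u_i} f_{Λ_i} θ_{v_i}⁻¹` of a single nonzero
element of the inverse hull of a `0`-cancellative semigroup admitting least common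
multiples. -/
theorem inverseHull.equality {S : Type*} [SemigroupWithZero S]
    (hlc : ZeroLeftCancellative S) (hrc : ZeroRightCancellative S)
    (hlcm : ∀ s t : S, ∃ r : S, IsLCM s t r)
    (Λ₁ Λ₂ : Finset (Option S)) (u₁ v₁ u₂ v₂ : Option S)
    (h1S : ∃ s : S, some s ∈ Λ₁) (h2S : ∃ s : S, some s ∈ Λ₂)
    (hu1 : u₁ ∈ Λ₁) (hv1 : v₁ ∈ Λ₁) (hu2 : u₂ ∈ Λ₂) (hv2 : v₂ ∈ Λ₂)
    (heq : triple u₁ (↑Λ₁) v₁ = triple u₂ (↑Λ₂) v₂)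
    (hne : ∃ x z : S, triple u₁ (↑Λ₁) v₁ x z) :
    ∃ x₁ x₂ : Option S,
      triple u₁ (↑Λ₁) v₁ =
        triple (tmul u₁ x₁) ((fun w => tmul w x₁) '' ↑Λ₁) (tmul v₁ x₁) ∧
      triple u₂ (↑Λ₂) v₂ =
        triple (tmul u₂ x₂) ((fun w => tmul w x₂) '' ↑Λ₂) (tmul v₂ x₂) ∧
      tmul u₁ x₁ = tmul u₂ x₂ ∧
      FLam ((fun w => tmul w x₁) '' ↑Λ₁) = FLam ((fun w => tmul w x₂) '' ↑Λ₂) ∧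
      (tmul v₁ x₁ = tmul v₂ x₂ ∨
        ((∃ w : S, tmul v₁ x₁ = some w ∧ w * w = w) ∧
          NatLE (idOn (FLam ((fun w => tmul w x₁) '' ↑Λ₁))) (etheta (tmul v₁ x₁)) ∧
          v₂ = none ∧ x₂ = none) ∨
        ((∃ w : S, tmul v₂ x₂ = some w ∧ w * w = w) ∧
          NatLE (idOn (FLam ((fun w => tmul w x₂) '' ↑Λ₂))) (etheta (tmul v₂ x₂)) ∧
          v₁ = none ∧ x₁ = none)) := by
  obtain ⟨x₁, x₂, hx, hdiv⟩ := exists_tmul_eq_tmul hlc hlcm u₁ u₂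
  have hfac₁ : ∀ m ∈ FLam (Λ₁ : Set (Option S)), ∃ y, m = tact x₁ y := by
    intro m hm
    obtain ⟨m₂, -, -, hb⟩ :=
      (triple_iff hu2 hv2).1 (heq ▸ (triple_iff hu1 hv1).2 ⟨m, hm, rfl, rfl⟩)
    obtain ⟨y, hy, -⟩ := hdiv m m₂ hb (mem_FLam_iff.1 hm _ hu1)
    exact ⟨y, hy⟩
  have hfac₂ : ∀ m ∈ FLam (Λ₂ : Set (Option S)), ∃ y, m = tact x₂ y := by
    intro m hm
    obtain ⟨m₁, -, -, hb⟩ :=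
      (triple_iff hu1 hv1).1 (heq.symm ▸ (triple_iff hu2 hv2).2 ⟨m, hm, rfl, rfl⟩)
    obtain ⟨y, -, hy⟩ := hdiv m₁ m hb.symm (hb ▸ mem_FLam_iff.1 hm _ hu2)
    exact ⟨y, hy⟩
  have hagree₁ := fun y => tact_eq_of_triple_le (y := y) hlc hu1 hv1 hu2 hv2 heq.le hx
  have hagree₂ := fun y => tact_eq_of_triple_le (y := y) hlc hu2 hv2 hu1 hv1 heq.ge hx.symm
  refine ⟨x₁, x₂, triple_eq_triple_tmul hu1 hv1 hfac₁, triple_eq_triple_tmul hu2 hv2 hfac₂, hx,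
    Set.ext fun y => ?_, ?_⟩
  · rw [mem_FLam_image_iff, mem_FLam_image_iff]
    exact ⟨fun h => (hagree₁ y h).1, fun h => (hagree₂ y h).1⟩
  obtain ⟨a, b, hab⟩ := hne
  obtain ⟨y, hy⟩ : ∃ y, tact x₁ y ∈ FLam (Λ₁ : Set (Option S)) := by
    obtain ⟨m, hm, -⟩ := (triple_iff hu1 hv1).1 hab
    obtain ⟨y, rfl⟩ := hfac₁ m hm
    exact ⟨y, hm⟩
  have hact₁ : ∀ y, tact x₁ y ∈ FLam (Λ₁ : Set (Option S)) →
      tact (tmul v₁ x₁) y = tact (tmul v₂ x₂) y ∧ tact (tmul v₁ x₁) y ≠ 0 := fun y h => by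
    rw [tact_tmul, tact_tmul]
    exact ⟨(hagree₁ y h).2, mem_FLam_iff.1 h _ hv1⟩
  have hact₂ : ∀ y, tact x₂ y ∈ FLam (Λ₂ : Set (Option S)) →
      tact (tmul v₂ x₂) y = tact (tmul v₁ x₁) y ∧ tact (tmul v₂ x₂) y ≠ 0 := fun y h => by
    rw [tact_tmul, tact_tmul]
    exact ⟨(hagree₂ y h).2, mem_FLam_iff.1 h _ hv2⟩
  obtain ⟨hy₁, hy0⟩ := hact₁ y hy
  rcases h₁ : tmul v₁ x₁ with _ | w₁ <;> rcases h₂ : tmul v₂ x₂ with _ | w₂ <;>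
    rw [h₁, h₂] at hy₁ hact₁ hact₂ <;> rw [h₁] at hy0
  · exact Or.inl rfl
  · refine Or.inr (Or.inr ⟨⟨w₂, rfl, mul_self_of_mul_eq hrc hy₁.symm hy0⟩, ?_, tmul_eq_none h₁⟩)
    refine natLE_idOn_etheta fun z hz => ?_
    obtain ⟨e, h0⟩ := hact₂ z (mem_FLam_image_iff.1 hz)
    exact ⟨e, ne_zero_of_tact_ne_zero h0⟩
  · refine Or.inr (Or.inl ⟨⟨w₁, rfl, mul_self_of_mul_eq hrc hy₁
      (ne_zero_of_tact_ne_zero hy0)⟩, ?_, tmul_eq_none h₂⟩)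
    refine natLE_idOn_etheta fun z hz => ?_
    obtain ⟨e, h0⟩ := hact₁ z (mem_FLam_image_iff.1 hz)
    exact ⟨e, ne_zero_of_tact_ne_zero h0⟩
  · exact Or.inl (congrArg some (hrc w₁ w₂ y hy₁ hy0))
end

section
/- Let S be a 0-left cancellative semigroup with zero, let r ∈ S, and let σ be a maximal string with σ ∈ F⋆_r. Then θ⋆_r(σ) = r∗σ is a maximal string. -/
/-- A string in `S`: a nonempty subset not containing `0`, closed under divisors,
and directed with respect to divisibility. -/
def IsString {S : Type*} [SemigroupWithZero S] (σ : Set S) : Prop :=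
  σ.Nonempty ∧ (0 : S) ∉ σ ∧
  (∀ s t : S, Divides s t → t ∈ σ → s ∈ σ) ∧
  (∀ s₁ ∈ σ, ∀ s₂ ∈ σ, ∃ s ∈ σ, Divides s₁ s ∧ Divides s₂ s)

/-- `r ∗ σ`, the set of divisors of elements of `rσ`. -/
def star {S : Type*} [SemigroupWithZero S] (r : S) (σ : Set S) : Set S :=
  {t | ∃ s ∈ σ, Divides t (r * s)}

/-- `r⁻¹ ∗ σ = {t ∈ S : rt ∈ σ}`. -/
def starInv {S : Type*} [SemigroupWithZero S] (r : S) (σ : Set S) : Set S :=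
  {t | r * t ∈ σ}

/-- `F⋆_r`, the domain of `θ⋆_r`: the strings `σ` with `0 ∉ rσ`. -/
def Fstar {S : Type*} [SemigroupWithZero S] (r : S) : Set (Set S) :=
  {σ | IsString σ ∧ ∀ s ∈ σ, r * s ≠ 0}

/-- `E⋆_r`, the range of `θ⋆_r`: the strings `σ` with `σ ∩ rS ≠ ∅`. -/
def Estar {S : Type*} [SemigroupWithZero S] (r : S) : Set (Set S) :=
  {σ | IsString σ ∧ ∃ t ∈ σ, ∃ x, t = r * x}

theorem Divides.rfl {S : Type*} [Mul S] {s : S} : Divides s s := Or.inl (Eq.refl s)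

theorem Divides.trans {S : Type*} [Semigroup S] {a b c : S}
    (hab : Divides a b) (hbc : Divides b c) : Divides a c := by
  rcases hab with rfl | ⟨u, rfl⟩
  · exact hbc
  · rcases hbc with rfl | ⟨v, rfl⟩
    · exact Or.inr ⟨u, Eq.refl _⟩
    · exact Or.inr ⟨u * v, (mul_assoc a u v).symm⟩

theorem Divides.mul_left {S : Type*} [Semigroup S] (r : S) {a b : S}
    (h : Divides a b) : Divides (r * a) (r * b) := by
  rcases h with rfl | ⟨u, rfl⟩
  · exact .rfl
  · exact Or.inr ⟨u, mul_assoc r a u⟩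

/-- A multiple of `r * s` is `r` times a multiple of `s`. -/
theorem Divides.exists_eq_mul {S : Type*} [Semigroup S] {r s w : S}
    (h : Divides (r * s) w) : ∃ p, Divides s p ∧ w = r * p := by
  rcases h with rfl | ⟨u, rfl⟩
  · exact ⟨s, .rfl, Eq.refl _⟩
  · exact ⟨s * u, Or.inr ⟨u, Eq.refl _⟩, mul_assoc r s u⟩

theorem IsString.star {S : Type*} [SemigroupWithZero S] {r : S} {σ : Set S}
    (hF : σ ∈ Fstar r) : IsString (star r σ) := by
  obtain ⟨⟨⟨s, hs⟩, -, -, hdir⟩, hne⟩ := hF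
  refine ⟨⟨r * s, s, hs, .rfl⟩, ?_, ?_, ?_⟩
  · rintro ⟨t, ht, h | ⟨u, h⟩⟩
    · exact hne t ht h
    · exact hne t ht (by rw [← h, zero_mul])
  · rintro a b hab ⟨t, ht, hbt⟩
    exact ⟨t, ht, hab.trans hbt⟩
  · rintro a ⟨s₁, hs₁, ha⟩ b ⟨s₂, hs₂, hb⟩
    obtain ⟨t, ht, h₁, h₂⟩ := hdir s₁ hs₁ s₂ hs₂
    exact ⟨r * t, ⟨t, ht, .rfl⟩, ha.trans (h₁.mul_left r), hb.trans (h₂.mul_left r)⟩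

theorem IsString.starInv {S : Type*} [SemigroupWithZero S] (hlc : ZeroLeftCancellative S)
    {r : S} {τ : Set S} (hτ : IsString τ) (hne : (starInv r τ).Nonempty) :
    IsString (starInv r τ) := by
  obtain ⟨-, h0, hdiv, hdir⟩ := hτ
  refine ⟨hne, ?_, fun a b hab hb => hdiv _ _ (hab.mul_left r) hb, ?_⟩
  · intro h
    exact h0 (mul_zero r ▸ h)
  · intro a ha b hb
    obtain ⟨w, hw, haw, hbw⟩ := hdir _ ha _ hb
    obtain ⟨p, hap, rfl⟩ := haw.exists_eq_mul
    obtain ⟨q, hbq, hpq⟩ := hbw.exists_eq_mul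
    obtain rfl := hlc r p q hpq fun h => h0 (h ▸ hw)
    exact ⟨p, hw, hap, hbq⟩

/-- If `σ` is a maximal string in the domain `F⋆_r` of `θ⋆_r`, then
`θ⋆_r(σ) = r∗σ` is a maximal string. -/
theorem strings.forwardInvariance {S : Type*} [SemigroupWithZero S]
    (hlc : ZeroLeftCancellative S)
    (r : S) (σ : Set S) (hσ : IsString σ)
    (hmax : ∀ τ : Set S, IsString τ → σ ⊆ τ → σ = τ)
    (hF : σ ∈ Fstar r) :
    IsString (star r σ) ∧ ∀ τ : Set S, IsString τ → star r σ ⊆ τ → star r σ = τ := by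
  refine ⟨.star hF, fun τ hτ hsub => hsub.antisymm ?_⟩
  have hle : σ ⊆ starInv r τ := fun s hs => hsub ⟨s, hs, .rfl⟩
  have heq := hmax _ (hτ.starInv hlc (hσ.1.mono hle)) hle
  obtain ⟨s, hs⟩ := hσ.1
  intro t ht
  obtain ⟨w, hw, htw, hsw⟩ := hτ.2.2.2 t ht _ (hle hs)
  obtain ⟨p, -, rfl⟩ := hsw.exists_eq_mul
  have hp : p ∈ σ := heq ▸ hw
  exact ⟨p, hp, htw⟩
end
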